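/- For all integers n ≥ 1 and k ≥ 1, the number of elements of NC^k_B(n) equals binom((k+1)n, n). -/

import Mathlib

open Finset

/-- A finpartition of a linearly ordered set is non-crossing if there are no
`a < b < c < d` with `a, c` in one block and `b, d` in a different block. -/
def IsNoncrossing {n : ℕ} (π : Finpartition (Finset.univ : Finset (Fin n))) : Prop :=
  ∀ a b c d : Fin n, a < b → b < c → c < d →
    ∀ B ∈ π.parts, ∀ C ∈ π.parts, a ∈ B → c ∈ B → b ∈ C → d ∈ C → B = C

/-- Filter by an arbitrary (possibly non-decidable) predicate. -/
noncomputable def fil {α : Type*} (s : Finset α) (p : α → Prop) : Finset α :=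
  letI := Classical.decPred p
  s.filter p

/-- Negation on `[±n] = {1,…,n,-1,…,-n}`, identified with `Fin (2n)` via
`i ↦ i - 1` and `-i ↦ n + i - 1` (zero-based).  It is given by adding `n` modulo `2n`. -/
def negB {n : ℕ} (x : Fin (2 * n)) : Fin (2 * n) :=
  ⟨(x.val + n) % (2 * n), Nat.mod_lt _ (by have := x.isLt; omega)⟩

/-- `-V` for a block `V`. -/
def negBlock {n : ℕ} (V : Finset (Fin (2 * n))) : Finset (Fin (2 * n)) :=
  V.image negB

/-- `NCB n` : non-crossing partitions of type `B_n`, i.e. non-crossing partitions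
of `[±n]` such that `-V` is a block whenever `V` is, with at most one block `V`
satisfying `-V = V` (the zero-block). -/
noncomputable def NCB (n : ℕ) : Finset (Finpartition (Finset.univ : Finset (Fin (2 * n)))) :=
  fil Finset.univ (fun π => IsNoncrossing π ∧ (∀ B ∈ π.parts, negBlock B ∈ π.parts) ∧
    (π.parts.filter (fun B => negBlock B = B)).card ≤ 1)

/-- The number of unordered pairs `{V, -V}` of non-zero blocks of `π` with `|V| = t`. -/
def pairCount {n : ℕ} (π : Finpartition (Finset.univ : Finset (Fin (2 * n)))) (t : ℕ) : ℕ :=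
  (π.parts.filter (fun B => negBlock B ≠ B ∧ B.card = t)).card / 2

/-- The number of unordered pairs `{V, -V}` of non-zero blocks of `π` (of any size). -/
def totalPairCount {n : ℕ} (π : Finpartition (Finset.univ : Finset (Fin (2 * n)))) : ℕ :=
  (π.parts.filter (fun B => negBlock B ≠ B)).card / 2

/-- The cardinality of the zero-block of `π` (`0` if there is no zero-block). -/
def zeroBlockSize {n : ℕ} (π : Finpartition (Finset.univ : Finset (Fin (2 * n)))) : ℕ :=
  ∑ B ∈ π.parts.filter (fun B => negBlock B = B), B.card

/-- `NCBdiv k n` : the `k`-divisible non-crossing partitions of type `B_{kn}`. -/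
noncomputable def NCBdiv (k n : ℕ) :
    Finset (Finpartition (Finset.univ : Finset (Fin (2 * (k * n))))) :=
  fil (NCB (k * n)) (fun π => ∀ B ∈ π.parts, k ∣ B.card)

/-! ### Part 1: start relations on the integers -/

/-- `P i j` is to be read as: `j` lies in a (non-zero) block whose first element is `i`. -/
structure NCS (m : ℤ) (P : ℤ → ℤ → Prop) : Prop where
  func : ∀ i i' j, P i j → P i' j → i = i'
  le : ∀ i j, P i j → i ≤ j
  base : ∀ i j, P i j → P i i
  nest : ∀ i j y, P i j → i < y → y ≤ j → ∃ i', i ≤ i' ∧ P i' y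
  shift : ∀ i j, P (i + m) (j + m) ↔ P i j

/-- The height increment of the walk attached to `f`. -/
noncomputable def FW (f : ℤ → ℕ) (i j : ℤ) : ℤ := ∑ t ∈ Finset.Ico i j, ((f t : ℤ) - 1)

/-- The start relation attached to `f`. -/
def StF (f : ℤ → ℕ) (i j : ℤ) : Prop :=
  i ≤ j ∧ 0 ≤ FW f i (j + 1) ∧ ∀ i', i < i' → i' ≤ j → FW f i' (j + 1) < 0

open Classical in
/-- The number of elements whose block starts at `i`. -/
noncomputable def cntP (m : ℤ) (P : ℤ → ℤ → Prop) (i : ℤ) : ℕ :=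
  ((Finset.Ico i (i + m)).filter (P i)).card

lemma FW_add (f : ℤ → ℕ) {a b c : ℤ} (hab : a ≤ b) (hbc : b ≤ c) :
    FW f a b + FW f b c = FW f a c := by
  unfold FW
  rw [← Finset.Ico_union_Ico_eq_Ico hab hbc, Finset.sum_union]
  exact Finset.Ico_disjoint_Ico_consecutive a b c

lemma FW_self (f : ℤ → ℕ) (a : ℤ) : FW f a a = 0 := by simp [FW]

lemma FW_succ (f : ℤ → ℕ) (a : ℤ) : FW f a (a + 1) = (f a : ℤ) - 1 := by
  have : Finset.Ico a (a + 1) = {a} := by ext x; simp; omega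
  simp [FW, this]

lemma FW_shift (f : ℤ → ℕ) (m : ℤ) (hper : ∀ t, f (t + m) = f t) (a b : ℤ) :
    FW f (a + m) (b + m) = FW f a b := by
  unfold FW
  symm
  refine Finset.sum_bij (fun t _ => t + m) ?_ ?_ ?_ ?_
  · intro t ht
    simp only [Finset.mem_Ico] at ht ⊢
    omega
  · intro x _ y _ h
    omega
  · intro y hy
    simp only [Finset.mem_Ico] at hy
    exact ⟨y - m, by simp only [Finset.mem_Ico]; omega, by omega⟩
  · intro t _
    rw [hper]

lemma FW_period (f : ℤ → ℕ) (m : ℤ) (hm : 0 < m) (hper : ∀ t, f (t + m) = f t) (a : ℤ) :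
    FW f a (a + m) = FW f 0 m := by
  have step : ∀ a, FW f (a + 1) (a + 1 + m) = FW f a (a + m) := by
    intro a
    have h1 := FW_add f (a := a) (b := a + 1) (c := a + 1 + m) (by omega) (by omega)
    have h2 := FW_add f (a := a) (b := a + m) (c := a + m + 1) (by omega) (by omega)
    have h3 := FW_succ f a
    have h4 := FW_succ f (a + m)
    rw [hper] at h4
    have e : a + 1 + m = a + m + 1 := by ring
    rw [e] at h1 ⊢
    linarith
  induction a using Int.induction_on with
  | zero => simp
  | succ i ih => rw [step]; exact ih
  | pred i ih => rw [← ih, ← step]; congr 1 <;> ring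

lemma NCS.shift_nat {m : ℤ} {P : ℤ → ℤ → Prop} (h : NCS m P) (i j : ℤ) (t : ℕ) :
    P (i + m * t) (j + m * t) ↔ P i j := by
  induction t with
  | zero => simp
  | succ t ih =>
    rw [← ih, ← h.shift (i + m * t)]
    push_cast
    rw [show i + m * (t + 1) = i + m * t + m by ring, show j + m * (t + 1) = j + m * t + m by ring]

lemma NCS.shift_int {m : ℤ} {P : ℤ → ℤ → Prop} (h : NCS m P) (i j : ℤ) (t : ℤ) :
    P (i + m * t) (j + m * t) ↔ P i j := by
  obtain ⟨s, rfl | rfl⟩ := t.eq_nat_or_neg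
  · exact h.shift_nat i j s
  · rw [← h.shift_nat _ _ s]
    simp

lemma NCS.lt {m : ℤ} {P : ℤ → ℤ → Prop} (hm : 0 < m) (h : NCS m P) {i j : ℤ} (hp : P i j) :
    j < i + m := by
  by_contra hc
  push Not at hc
  have hs : P (i - m) (j - m) := by
    rw [← h.shift]; simpa using hp
  rcases eq_or_lt_of_le hc with hc | hc
  · have hb := h.base _ _ hp
    have : j - m = i := by omega
    rw [this] at hs
    have := h.func _ _ _ hs hb
    omega
  · obtain ⟨i', h1, h2⟩ := h.nest _ _ (j - m) hp (by omega) (by omega)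
    have := h.func _ _ _ hs h2
    omega

open Classical in
lemma NCS.FW_eq {m : ℤ} {P : ℤ → ℤ → Prop} (hm : 0 < m) (h : NCS m P) (i j : ℤ) (hij : i ≤ j) :
    ∃ D : Finset ℤ, (∀ y, y ∈ D ↔ ∃ t, i ≤ t ∧ t < j ∧ P t y) ∧
      FW (cntP m P) i j = (D.card : ℤ) - (j - i) := by
  refine ⟨(Finset.Ico i j).biUnion (fun t => (Finset.Ico t (t + m)).filter (P t)), ?_, ?_⟩
  · intro y
    simp only [Finset.mem_biUnion, Finset.mem_Ico, Finset.mem_filter]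
    constructor
    · rintro ⟨t, ⟨a, b⟩, _, c⟩
      exact ⟨t, a, b, c⟩
    · rintro ⟨t, a, b, c⟩
      exact ⟨t, ⟨a, b⟩, ⟨h.le _ _ c, h.lt hm c⟩, c⟩
  · rw [Finset.card_biUnion]
    · unfold FW cntP
      rw [Finset.sum_sub_distrib]
      simp
      omega
    · intro x _ y _ hxy
      refine Finset.disjoint_left.2 ?_
      intro a ha hb
      simp only [Finset.mem_filter] at ha hb
      exact hxy (h.func _ _ _ ha.2 hb.2)

lemma NCS.FW_neg {m : ℤ} {P : ℤ → ℤ → Prop} (hm : 0 < m) (h : NCS m P) (i j : ℤ) (hij : i ≤ j)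
    (hs : ∀ s, P s j → s < i) : FW (cntP m P) i (j + 1) < 0 := by
  obtain ⟨D, hD, hF⟩ := h.FW_eq hm i (j + 1) (by omega)
  have hsub : D ⊆ Finset.Ico i j := by
    intro y hy
    obtain ⟨t, h1, h2, h3⟩ := (hD y).1 hy
    have := h.le _ _ h3
    rw [Finset.mem_Ico]
    refine ⟨by omega, ?_⟩
    by_contra hc
    rcases eq_or_lt_of_le (show t ≤ j by omega) with e | e
    · subst e
      have := hs _ (h.base _ _ h3)
      omega
    · obtain ⟨i', h4, h5⟩ := h.nest _ _ j h3 e (by omega)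
      have := hs _ h5
      omega
  have := Finset.card_le_card hsub
  simp at this
  omega

lemma NCS.FW_nonneg {m : ℤ} {P : ℤ → ℤ → Prop} (hm : 0 < m) (h : NCS m P) (s j : ℤ)
    (hs : P s j) : 0 ≤ FW (cntP m P) s (j + 1) := by
  have hsj := h.le _ _ hs
  obtain ⟨D, hD, hF⟩ := h.FW_eq hm s (j + 1) (by omega)
  have hsub : Finset.Ico s (j + 1) ⊆ D := by
    intro y hy
    rw [Finset.mem_Ico] at hy
    rw [hD]
    rcases eq_or_lt_of_le hy.1 with e | e
    · subst e
      exact ⟨s, le_rfl, by omega, h.base _ _ hs⟩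
    · obtain ⟨i', h4, h5⟩ := h.nest _ _ y hs e (by omega)
      have := h.le _ _ h5
      exact ⟨i', h4, by omega, h5⟩
  have := Finset.card_le_card hsub
  simp at this
  omega

lemma StF.func {f : ℤ → ℕ} {i i' j : ℤ} (h : StF f i j) (h' : StF f i' j) : i = i' := by
  rcases lt_trichotomy i i' with e | e | e
  · have := h.2.2 _ e h'.1
    have := h'.2.1
    omega
  · exact e
  · have := h'.2.2 _ e h.1
    have := h.2.1
    omega

lemma NCS.iff_StF {m : ℤ} {P : ℤ → ℤ → Prop} (hm : 0 < m) (h : NCS m P) (s j : ℤ) :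
    P s j ↔ StF (cntP m P) s j := by
  have key : ∀ s, P s j → StF (cntP m P) s j := by
    intro s hs
    refine ⟨h.le _ _ hs, h.FW_nonneg hm s j hs, ?_⟩
    intro i' h1 h2
    refine h.FW_neg hm i' j h2 ?_
    intro s' hs'
    rw [h.func _ _ _ hs' hs]; exact h1
  refine ⟨key s, fun hst => ?_⟩
  by_cases hex : ∃ s', P s' j
  · obtain ⟨s', hs'⟩ := hex
    rw [hst.func (key s' hs')]; exact hs'
  · exfalso
    have := h.FW_neg hm s j hst.1 (fun s' hs' => absurd ⟨s', hs'⟩ hex)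
    have := hst.2.1
    omega

open Classical in
lemma NCS.cnt_shift {m : ℤ} {P : ℤ → ℤ → Prop} (h : NCS m P) (i : ℤ) :
    cntP m P (i + m) = cntP m P i := by
  unfold cntP
  symm
  refine Finset.card_bij (fun y _ => y + m) ?_ ?_ ?_
  · intro y hy
    simp only [Finset.mem_filter, Finset.mem_Ico] at hy ⊢
    exact ⟨by omega, (h.shift _ _).2 hy.2⟩
  · intro a _ b _ hab
    omega
  · intro y hy
    simp only [Finset.mem_filter, Finset.mem_Ico] at hy
    refine ⟨y - m, ?_, by omega⟩
    simp only [Finset.mem_filter, Finset.mem_Ico]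
    refine ⟨by omega, ?_⟩
    rw [← h.shift]; simpa using hy.2

lemma NCS.FW_le {m : ℤ} {P : ℤ → ℤ → Prop} (hm : 0 < m) (h : NCS m P) :
    FW (cntP m P) 0 m ≤ 0 := by
  obtain ⟨D, hD, hF⟩ := h.FW_eq hm 0 m hm.le
  have : D.card ≤ (Finset.Ico 0 m).card := by
    refine Finset.card_le_card_of_injOn (fun y => y % m) ?_ ?_
    · intro y _
      simp only [Finset.coe_Ico, Set.mem_Ico]
      exact ⟨Int.emod_nonneg _ hm.ne', Int.emod_lt_of_pos _ hm⟩
    · intro y hy y' hy' hyy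
      obtain ⟨t, h1, h2, h3⟩ := (hD y).1 hy
      obtain ⟨t', h1', h2', h3'⟩ := (hD y').1 hy'
      obtain ⟨c, hc⟩ : m ∣ y' - y := Int.ModEq.dvd hyy
      have h4 := (h.shift_int t y c).2 h3
      rw [← hc, add_sub_cancel] at h4
      have h5 := h.func _ _ _ h4 h3'
      have : c = 0 := by
        rcases lt_trichotomy c 0 with e | e | e
        · nlinarith
        · exact e
        · nlinarith
      subst this
      omega
  simp at this
  omega

lemma StF_of_le {f : ℤ → ℕ} {i y : ℤ} (hiy : i ≤ y) (h : 0 ≤ FW f i (y + 1)) :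
    ∃ i', i ≤ i' ∧ StF f i' y := by
  obtain ⟨b, ⟨h1, h2⟩, h3⟩ := Int.exists_greatest_of_bdd
    (P := fun t => t ≤ y ∧ 0 ≤ FW f t (y + 1)) ⟨y, fun z hz => hz.1⟩ ⟨i, hiy, h⟩
  refine ⟨b, h3 i ⟨hiy, h⟩, h1, h2, ?_⟩
  intro i' h4 h5
  by_contra hc
  have := h3 i' ⟨h5, by omega⟩
  omega

lemma StF.FW_le {f : ℤ → ℕ} {i j y : ℤ} (h : StF f i j) (h1 : i ≤ y) (h2 : y ≤ j) :
    0 ≤ FW f i (y + 1) := by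
  have h3 := FW_add f (a := i) (b := y + 1) (c := j + 1) (by omega) (by omega)
  have h4 := h.2.1
  rcases eq_or_lt_of_le h2 with e | e
  · subst e; exact h4
  · have := h.2.2 (y + 1) (by omega) (by omega)
    omega

lemma NCS_StF (f : ℤ → ℕ) (m : ℤ) (hper : ∀ t, f (t + m) = f t) : NCS m (StF f) where
  func := fun i i' j h h' => h.func h'
  le := fun i j h => h.1
  base := fun i j h => ⟨le_rfl, h.FW_le le_rfl h.1, fun i' h1 h2 => by omega⟩
  nest := fun i j y h h1 h2 => StF_of_le h1.le (h.FW_le h1.le h2)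
  shift := by
    intro i j
    unfold StF
    have e : ∀ i, FW f (i + m) (j + m + 1) = FW f i (j + 1) := by
      intro i
      rw [← FW_shift f m hper i (j + 1)]; congr 1; ring
    rw [e]
    refine and_congr (by omega) (and_congr Iff.rfl ⟨?_, ?_⟩)
    · intro h i' h1 h2
      rw [← e]
      exact h _ (by omega) (by omega)
    · intro h i' h1 h2
      have := e (i' - m)
      rw [sub_add_cancel] at this
      rw [this]
      exact h _ (by omega) (by omega)

open Classical in
lemma cnt_StF (f : ℤ → ℕ) (m : ℤ) (hm : 0 < m) (hper : ∀ t, f (t + m) = f t)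
    (hF : FW f 0 m ≤ 0) (i : ℤ) : cntP m (StF f) i = f i := by
  have hN := NCS_StF f m hper
  have hFi : FW f i (i + m) ≤ 0 := by rw [FW_period f m hm hper]; exact hF
  have : cntP m (StF f) i = (Finset.Ico (0 : ℤ) (f i)).card := by
    unfold cntP
    refine Finset.card_bij (fun y _ => FW f i (y + 1)) ?_ ?_ ?_
    · intro y hy
      simp only [Finset.mem_filter, Finset.mem_Ico] at hy ⊢
      obtain ⟨_, h1, h2, h3⟩ := hy
      refine ⟨h2, ?_⟩
      have h4 := FW_succ f i
      rcases eq_or_lt_of_le h1 with e | e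
      · subst e; omega
      · have h5 := h3 (i + 1) (by omega) (by omega)
        have := FW_add f (a := i) (b := i + 1) (c := y + 1) (by omega) (by omega)
        omega
    · intro a ha b hb hab
      simp only [Finset.mem_filter, Finset.mem_Ico] at ha hb
      have aux : ∀ a b, StF f i a → StF f i b → a < b → FW f i (b + 1) < FW f i (a + 1) := by
        intro a b ha hb hab
        have h5 := hb.2.2 (a + 1) (by have := ha.1; omega) (by omega)
        have := FW_add f (a := i) (b := a + 1) (c := b + 1) (by have := ha.1; omega) (by omega)
        omega
      rcases lt_trichotomy a b with e | e | e
      · have := aux _ _ ha.2 hb.2 e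
        omega
      · exact e
      · have := aux _ _ hb.2 ha.2 e
        omega
    · intro v hv
      rw [Finset.mem_Ico] at hv
      obtain ⟨x, ⟨h1, h2⟩, h3⟩ := Int.exists_least_of_bdd
        (P := fun x => i ≤ x ∧ FW f i (x + 1) ≤ v) ⟨i, fun z hz => hz.1⟩
        ⟨i + m - 1, by omega, by rw [sub_add_cancel]; omega⟩
      have h3' : ∀ i', i < i' → i' ≤ x → v < FW f i i' := by
        intro i' h4 h5
        by_contra hc
        have := h3 (i' - 1) ⟨by omega, by rw [sub_add_cancel]; omega⟩
        omega
      have hx : FW f i (x + 1) = v := by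
        have h4 := FW_succ f x
        rcases eq_or_lt_of_le h1 with e | e
        · subst e; omega
        · have := h3' x e le_rfl
          have := FW_add f (a := i) (b := x) (c := x + 1) (by omega) (by omega)
          omega
      have hst : StF f i x := by
        refine ⟨h1, by omega, ?_⟩
        intro i' h4 h5
        have := h3' i' h4 h5
        have := FW_add f (a := i) (b := i') (c := x + 1) (by omega) (by omega)
        omega
      refine ⟨x, ?_, hx⟩
      simp only [Finset.mem_filter, Finset.mem_Ico]
      exact ⟨⟨h1, hN.lt hm hst⟩, hst⟩
  rw [this]; simp

/-! ### Part 2: block relations on the integers -/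

/-- A type-B non-crossing equivalence relation, lifted to the integers. -/
structure CR (m : ℤ) (R : ℤ → ℤ → Prop) : Prop where
  refl : ∀ x, R x x
  symm : ∀ x y, R x y → R y x
  trans : ∀ x y z, R x y → R y z → R x z
  per : ∀ x, R x (x + 2 * m)
  shift : ∀ x y, R (x + m) (y + m) ↔ R x y
  nc : ∀ a b c d, a < b → b < c → c < d → d < a + 2 * m → R a c → R b d → R a b

/-- The start relation of a block relation. -/
def PR (m : ℤ) (R : ℤ → ℤ → Prop) (i j : ℤ) : Prop :=
  i ≤ j ∧ j < i + m ∧ R i j ∧ ¬ R i (i + m) ∧ ∀ y, i - m < y → y < i → ¬ R y i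

/-- The block relation of a start relation. -/
def RP (m : ℤ) (P : ℤ → ℤ → Prop) (x y : ℤ) : Prop :=
  ((∀ i, ¬ P i x) ∧ (∀ i, ¬ P i y)) ∨ ∃ i i', P i x ∧ P i' y ∧ 2 * m ∣ i' - i

lemma CR.per_nat {m : ℤ} {R : ℤ → ℤ → Prop} (h : CR m R) (x : ℤ) (t : ℕ) :
    R x (x + 2 * m * t) := by
  induction t with
  | zero => simpa using h.refl x
  | succ t ih =>
    have := h.trans _ _ _ ih (h.per _)
    convert this using 1
    push_cast; ring

lemma CR.per_int {m : ℤ} {R : ℤ → ℤ → Prop} (h : CR m R) (x t : ℤ) :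
    R x (x + 2 * m * t) := by
  obtain ⟨s, rfl | rfl⟩ := t.eq_nat_or_neg
  · exact h.per_nat x s
  · have := h.symm _ _ (h.per_nat (x + 2 * m * (-s)) s)
    convert this using 1
    ring

lemma CR.per_dvd {m : ℤ} {R : ℤ → ℤ → Prop} (h : CR m R) {x y : ℤ} (hd : 2 * m ∣ y - x) :
    R x y := by
  obtain ⟨c, hc⟩ := hd
  have := h.per_int x c
  rw [← hc] at this
  simpa using this

/-- Being in the zero block is invariant along the relation. -/
lemma CR.zero_congr {m : ℤ} {R : ℤ → ℤ → Prop} (h : CR m R) {x y : ℤ} (hxy : R x y)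
    (hx : R x (x + m)) : R y (y + m) :=
  h.trans _ _ _ (h.symm _ _ hxy) (h.trans _ _ _ hx ((h.shift _ _).2 hxy))

lemma CR.sub_shift {m : ℤ} {R : ℤ → ℤ → Prop} (h : CR m R) {x y : ℤ} (hxy : R x y) :
    R (x - m) (y - m) := by
  rw [← h.shift]; simpa using hxy

lemma CR.zero_int {m : ℤ} {R : ℤ → ℤ → Prop} (h : CR m R) {x : ℤ} (hx : R x (x + m)) (t : ℤ) :
    R x (x + m * t) := by
  obtain ⟨s, hs | hs⟩ := t.even_or_odd'
  · rw [hs]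
    have := h.per_int x s
    convert this using 1; ring
  · rw [hs]
    have := h.trans _ _ _ hx (h.per_int (x + m) s)
    convert this using 1; ring

lemma CR.zero_unique {m : ℤ} (hm : 0 < m) {R : ℤ → ℤ → Prop} (h : CR m R) {x y : ℤ}
    (hx : R x (x + m)) (hy : R y (y + m)) : R x y := by
  -- move `y` into `[x, x + m)`
  set t := (y - x) / m with ht
  have e1 := Int.emod_add_mul_ediv (y - x) m
  have e2 := Int.emod_nonneg (y - x) hm.ne'
  have e3 := Int.emod_lt_of_pos (y - x) hm
  have hy' : R y (y + m * (-t)) := h.zero_int hy (-t)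
  set w := y + m * (-t) with hw
  have hwx : w - x = (y - x) % m := by rw [hw]; linarith
  have hww : R w (w + m) := h.zero_congr hy' hy
  refine h.trans _ _ _ ?_ (h.symm _ _ hy')
  rcases eq_or_lt_of_le (show x ≤ w by omega) with e | e
  · rw [← e]; exact h.refl x
  · exact h.nc x w (x + m) (w + m) e (by omega) (by omega) (by omega) hx hww

lemma CR.exists_start {m : ℤ} (hm : 0 < m) {R : ℤ → ℤ → Prop} (h : CR m R) {y : ℤ}
    (hy : ¬ R y (y + m)) : ∃ i, PR m R i y := by
  obtain ⟨i, ⟨h1, h2, h3⟩, h4⟩ := Int.exists_least_of_bdd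
    (P := fun i => i ≤ y ∧ y < i + m ∧ R i y) ⟨y - m, fun z hz => by omega⟩
    ⟨y, le_rfl, by omega, h.refl y⟩
  refine ⟨i, h1, h2, h3, fun hc => hy (h.zero_congr h3 hc), ?_⟩
  intro w h5 h6 h7
  have hwy : R w y := h.trans _ _ _ h7 h3
  rcases lt_trichotomy (w + m) y with e | e | e
  · have h8 : R (y - m) (w + m) := by
      have a1 := (h.shift _ _).2 hwy
      have a2 := h.sub_shift (h.symm _ _ (h.per y))
      have a3 : R (y + m) (y - m) := by
        convert a2 using 1; ring
      exact h.symm _ _ (h.trans _ _ _ a1 a3)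
    have h9 := h.nc w (y - m) i (w + m) (by omega) (by omega) (by omega) (by omega) h7 h8
    apply hy
    have h10 := (h.shift _ _).2 (h.trans _ _ _ (h.symm _ _ hwy) h9)
    rw [sub_add_cancel] at h10
    exact h.symm _ _ h10
  · apply hy
    subst e
    exact h.zero_congr hwy hwy
  · have := h4 w ⟨by omega, e, hwy⟩
    omega

lemma PR.not_zero {m : ℤ} {R : ℤ → ℤ → Prop} (h : CR m R) {i y : ℤ} (hp : PR m R i y) :
    ¬ R y (y + m) := fun hc => hp.2.2.2.1 (h.zero_congr (h.symm _ _ hp.2.2.1) hc)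

lemma CR.NCS {m : ℤ} (hm : 0 < m) {R : ℤ → ℤ → Prop} (h : CR m R) : NCS m (PR m R) where
  func := by
    have key : ∀ i i' j, PR m R i j → PR m R i' j → ¬ i < i' := by
      intro i i' j h1 h2 hlt
      obtain ⟨a1, a2, a3, a4, a5⟩ := h1
      obtain ⟨b1, b2, b3, b4, b5⟩ := h2
      exact b5 i (by omega) hlt (h.trans _ _ _ a3 (h.symm _ _ b3))
    intro i i' j h1 h2
    have := key _ _ _ h1 h2
    have := key _ _ _ h2 h1
    omega
  le := fun i j hp => hp.1
  base := fun i j hp => ⟨le_rfl, by omega, h.refl i, hp.2.2.2⟩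
  nest := by
    intro i j y hp hiy hyj
    obtain ⟨a1, a2, a3, a4, a5⟩ := hp
    by_cases hy : R i y
    · exact ⟨i, le_rfl, hiy.le, by omega, hy, a4, a5⟩
    have hyj' : y < j := by
      rcases eq_or_lt_of_le hyj with e | e
      · subst e; exact absurd a3 hy
      · exact e
    have hz : ¬ R y (y + m) := fun hc =>
      hy (h.nc i y j (y + m) hiy hyj' (by omega) (by omega) a3 hc)
    obtain ⟨i', hi'⟩ := h.exists_start hm hz
    refine ⟨i', ?_, hi'⟩
    by_contra hc
    push Not at hc
    obtain ⟨b1, b2, b3, b4, b5⟩ := hi'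
    have := h.nc i' i y j hc hiy hyj' (by omega) b3 a3
    exact a5 i' (by omega) hc this
  shift := by
    intro i j
    unfold PR
    rw [h.shift, h.shift]
    refine and_congr (by omega) (and_congr (by omega) (and_congr Iff.rfl (and_congr Iff.rfl ?_)))
    constructor
    · intro hh y h1 h2 h3
      exact hh (y + m) (by omega) (by omega) ((h.shift _ _).2 h3)
    · intro hh y h1 h2 h3
      have := h.sub_shift h3
      rw [add_sub_cancel_right] at this
      exact hh (y - m) (by omega) (by omega) this

lemma CR.iff_RP {m : ℤ} (hm : 0 < m) {R : ℤ → ℤ → Prop} (h : CR m R) (x y : ℤ) :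
    R x y ↔ RP m (PR m R) x y := by
  have hz : ∀ x, (∀ i, ¬ PR m R i x) → R x (x + m) := by
    intro x hx
    by_contra hc
    obtain ⟨i, hi⟩ := h.exists_start hm hc
    exact hx i hi
  constructor
  · intro hxy
    by_cases hx : R x (x + m)
    · left
      exact ⟨fun i hi => hi.not_zero h hx, fun i hi => hi.not_zero h (h.zero_congr hxy hx)⟩
    · right
      have hy : ¬ R y (y + m) := fun hc => hx (h.zero_congr (h.symm _ _ hxy) hc)
      obtain ⟨i, hi⟩ := h.exists_start hm hx
      obtain ⟨i', hi'⟩ := h.exists_start hm hy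
      refine ⟨i, i', hi, hi', ?_⟩
      have hN := h.NCS hm
      -- move `i'` into `(i - m, i + m]`
      have hii : R i i' := h.trans _ _ _ hi.2.2.1 (h.trans _ _ _ hxy (h.symm _ _ hi'.2.2.1))
      set t := (i' - i + m) / (2 * m) with ht
      have e1 := Int.emod_add_mul_ediv (i' - i + m) (2 * m)
      have e2 := Int.emod_nonneg (i' - i + m) (show 2 * m ≠ 0 by omega)
      have e3 := Int.emod_lt_of_pos (i' - i + m) (show 0 < 2 * m by omega)
      have hb := hN.base _ _ hi'
      have hs : PR m R (i' + m * (2 * (-t))) (i' + m * (2 * (-t))) := (hN.shift_int _ _ _).2 hb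
      have hR : R i (i' + m * (2 * (-t))) := by
        refine h.trans _ _ _ hii ?_
        convert h.per_int i' (-t) using 1
        ring
      set w := i' + m * (2 * (-t)) with hw
      have hwi : w - i + m = (i' - i + m) % (2 * m) := by rw [hw]; linarith
      obtain ⟨a1, a2, a3, a4, a5⟩ := hi
      obtain ⟨b1, b2, b3, b4, b5⟩ := hs
      have hwi2 : w = i := by
        rcases lt_trichotomy w i with e | e | e
        · exfalso
          rcases eq_or_lt_of_le (show i - m ≤ w by omega) with e' | e'
          · have hw' : i = w + m := by omega
            rw [hw'] at hR
            exact b4 (h.symm _ _ hR)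
          · exact a5 w e' e (h.symm _ _ hR)
        · exact e
        · exact absurd hR (b5 i (by omega) e)
      refine ⟨t, ?_⟩
      rw [← hwi2, hw]; ring
  · rintro (⟨hx, hy⟩ | ⟨i, i', h1, h2, h3⟩)
    · exact h.zero_unique hm (hz x hx) (hz y hy)
    · exact h.trans _ _ _ (h.symm _ _ h1.2.2.1) (h.trans _ _ _ (h.per_dvd h3) h2.2.2.1)

lemma NCS.shift_dvd {m : ℤ} {P : ℤ → ℤ → Prop} (h : NCS m P) {i i' j : ℤ} (hp : P i j)
    (hd : 2 * m ∣ i' - i) : P i' (j + (i' - i)) := by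
  obtain ⟨c, hc⟩ := hd
  have := (h.shift_int i j (2 * c)).2 hp
  have e : m * (2 * c) = i' - i := by rw [hc]; ring
  rw [e] at this
  simpa using this

/-- If `2 * m` divides `i' - i` and `i < i'` then the difference is at least `2 * m`. -/
lemma dvd_ge {m i i' : ℤ} (hd : 2 * m ∣ i' - i) (hlt : i < i') : i + 2 * m ≤ i' := by
  have := Int.le_of_dvd (by omega) hd
  omega

lemma dvd_eq {m i i' : ℤ} (hd : 2 * m ∣ i' - i) (h1 : i' < i + 2 * m) (h2 : i < i' + 2 * m) :
    i = i' := by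
  rcases lt_trichotomy i i' with e | e | e
  · have := dvd_ge hd e; omega
  · exact e
  · have := dvd_ge ((dvd_sub_comm).1 hd) e; omega

lemma NCS.CR {m : ℤ} (hm : 0 < m) {P : ℤ → ℤ → Prop} (h : NCS m P) : CR m (RP m P) where
  refl := by
    intro x
    by_cases hx : ∃ i, P i x
    · obtain ⟨i, hi⟩ := hx
      exact Or.inr ⟨i, i, hi, hi, by simp⟩
    · push Not at hx
      exact Or.inl ⟨hx, hx⟩
  symm := by
    rintro x y (⟨h1, h2⟩ | ⟨i, i', h1, h2, h3⟩)
    · exact Or.inl ⟨h2, h1⟩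
    · exact Or.inr ⟨i', i, h2, h1, (dvd_sub_comm).1 h3⟩
  trans := by
    rintro x y z (⟨h1, h2⟩ | ⟨i, i', h1, h2, h3⟩) (⟨g1, g2⟩ | ⟨j, j', g1, g2, g3⟩)
    · exact Or.inl ⟨h1, g2⟩
    · exact absurd g1 (h2 _)
    · exact absurd h2 (g1 _)
    · right
      have := h.func _ _ _ h2 g1
      subst this
      refine ⟨i, j', h1, g2, ?_⟩
      obtain ⟨u, hu⟩ := h3
      obtain ⟨v, hv⟩ := g3
      exact ⟨u + v, by linarith⟩
  per := by
    intro x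
    by_cases hx : ∃ i, P i x
    · obtain ⟨i, hi⟩ := hx
      have := h.shift_dvd hi (i' := i + 2 * m) (by simp)
      rw [add_sub_cancel_left] at this
      exact Or.inr ⟨i, i + 2 * m, hi, this, by simp⟩
    · push Not at hx
      refine Or.inl ⟨hx, ?_⟩
      intro i hi
      have := h.shift_dvd hi (i' := i - 2 * m) (by simp)
      simp at this
      exact hx _ this
  shift := by
    intro x y
    have hs : ∀ i x, P i (x + m) ↔ P (i - m) x := by
      intro i x
      rw [← h.shift (i - m) x, sub_add_cancel]
    constructor
    · rintro (⟨h1, h2⟩ | ⟨i, i', h1, h2, h3⟩)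
      · refine Or.inl ⟨fun i hi => h1 (i + m) ((h.shift _ _).2 hi),
          fun i hi => h2 (i + m) ((h.shift _ _).2 hi)⟩
      · exact Or.inr ⟨i - m, i' - m, (hs _ _).1 h1, (hs _ _).1 h2, by simpa using h3⟩
    · rintro (⟨h1, h2⟩ | ⟨i, i', h1, h2, h3⟩)
      · exact Or.inl ⟨fun i hi => h1 _ ((hs _ _).1 hi), fun i hi => h2 _ ((hs _ _).1 hi)⟩
      · exact Or.inr ⟨i + m, i' + m, (h.shift _ _).2 h1, (h.shift _ _).2 h2, by simpa using h3⟩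
  nc := by
    intro a b c d hab hbc hcd hda hac hbd
    -- shifting a start by `2 * m`
    have up : ∀ i j, P i j → P (i + 2 * m) (j + 2 * m) := by
      intro i j hij
      have := h.shift_dvd hij (i' := i + 2 * m) (by simp)
      rwa [add_sub_cancel_left] at this
    have down : ∀ i j, P i (j + 2 * m) → P (i - 2 * m) j := by
      intro i j hij
      have := h.shift_dvd hij (i' := i - 2 * m) (by simp)
      simpa using this
    -- two starts, at positions at distance less than `2 * m`
    have two : ∀ i i' x y, P i x → P i' y → 2 * m ∣ i' - i → x < y → y < x + 2 * m →
        i' = i ∨ i' = i + 2 * m := by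
      intro i i' x y h1 h2 h3 h4 h5
      have b1 := h.le _ _ h1
      have b2 := h.lt hm h1
      have b3 := h.le _ _ h2
      have b4 := h.lt hm h2
      by_cases e : i < i'
      · right
        have h6 := dvd_ge h3 e
        have : 2 * m ∣ i' - (i + 2 * m) := by
          rw [← sub_sub]; exact dvd_sub h3 dvd_rfl
        have := dvd_eq this (by omega) (by omega)
        omega
      · left
        have := dvd_eq h3 (by omega) (by omega)
        omega
    rcases hac with ⟨ha, hc⟩ | ⟨i, i', ha, hc, hi⟩ <;>
      rcases hbd with ⟨hb, hd⟩ | ⟨p, q, hb, hd, hp⟩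
    · exact Or.inl ⟨ha, hb⟩
    · exfalso
      have b1 := h.le _ _ hb
      have b2 := h.le _ _ hd
      rcases two _ _ _ _ hb hd hp (by omega) (by omega) with e | e
      · obtain ⟨s, _, hs⟩ := h.nest _ _ c hd (by omega) hcd.le
        exact hc _ hs
      · have hb' := up _ _ hb
        obtain ⟨s, _, hs⟩ := h.nest _ _ (a + 2 * m) hb' (by omega) (by omega)
        exact ha _ (down _ _ hs)
    · exfalso
      have b1 := h.le _ _ ha
      have b2 := h.le _ _ hc
      rcases two _ _ _ _ ha hc hi (by omega) (by omega) with e | e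
      · obtain ⟨s, _, hs⟩ := h.nest _ _ b hc (by omega) hbc.le
        exact hb _ hs
      · have ha' := up _ _ ha
        obtain ⟨s, _, hs⟩ := h.nest _ _ d ha' (by omega) (by omega)
        exact hd _ hs
    · right
      have b1 := h.le _ _ ha
      have b2 := h.le _ _ hc
      have b3 := h.le _ _ hb
      have b4 := h.le _ _ hd
      refine ⟨i, p, ha, hb, ?_⟩
      rcases two _ _ _ _ ha hc hi (by omega) (by omega) with e | e <;>
        rcases two _ _ _ _ hb hd hp (by omega) (by omega) with e' | e'
      · obtain ⟨s, h1, hs⟩ := h.nest _ _ b hc (by omega) hbc.le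
        obtain ⟨r, h2, hr⟩ := h.nest _ _ c hd (by omega) hcd.le
        have := h.func _ _ _ hs hb
        have := h.func _ _ _ hr hc
        have : p - i = 0 := by omega
        simp [this]
      · obtain ⟨s, h1, hs⟩ := h.nest _ _ b hc (by omega) hbc.le
        obtain ⟨r, h2, hr⟩ := h.nest _ _ (a + 2 * m) (up _ _ hb) (by omega) (by omega)
        have := h.func _ _ _ hs hb
        have := h.func _ _ _ hr (up _ _ ha)
        have : p - i = 0 := by omega
        simp [this]
      · obtain ⟨s, h1, hs⟩ := h.nest _ _ d (up _ _ ha) (by omega) (by omega)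
        obtain ⟨r, h2, hr⟩ := h.nest _ _ c hd (by omega) hcd.le
        have := h.func _ _ _ hs hd
        have := h.func _ _ _ hr hc
        have : p - i = 2 * m := by omega
        simp [this]
      · obtain ⟨s, h1, hs⟩ := h.nest _ _ d (up _ _ ha) (by omega) (by omega)
        obtain ⟨r, h2, hr⟩ := h.nest _ _ (a + 2 * m) (up _ _ hb) (by omega) (by omega)
        have := h.func _ _ _ hs hd
        have := h.func _ _ _ hr (up _ _ ha)
        have : p - i = 0 := by omega
        simp [this]

lemma NCS.PR_iff {m : ℤ} (hm : 0 < m) {P : ℤ → ℤ → Prop} (h : NCS m P) (i j : ℤ) :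
    PR m (RP m P) i j ↔ P i j := by
  constructor
  · rintro ⟨h1, h2, h3, h4, h5⟩
    have hU : ∃ s, P s i := by
      by_contra hc
      push Not at hc
      refine h4 (Or.inl ⟨hc, fun s hs => hc (s - m) ?_⟩)
      rw [← h.shift, sub_add_cancel]; exact hs
    obtain ⟨s, hs⟩ := hU
    have b1 := h.le _ _ hs
    have b2 := h.lt hm hs
    have hsi : s = i := by
      by_contra hc
      exact h5 s (by omega) (by omega) (Or.inr ⟨s, s, h.base _ _ hs, hs, by simp⟩)
    subst hsi
    rcases h3 with ⟨g1, g2⟩ | ⟨r, r', g1, g2, g3⟩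
    · exact absurd hs (g1 _)
    · have := h.func _ _ _ g1 hs
      subst this
      have b3 := h.le _ _ g2
      have b4 := h.lt hm g2
      have := dvd_eq g3 (by omega) (by omega)
      rw [this]; exact g2
  · intro hp
    have hb := h.base _ _ hp
    refine ⟨h.le _ _ hp, h.lt hm hp, Or.inr ⟨i, i, hb, hp, by simp⟩, ?_, ?_⟩
    · rintro (⟨g1, g2⟩ | ⟨r, r', g1, g2, g3⟩)
      · exact g1 _ hb
      · have e1 := h.func _ _ _ g1 hb
        have e2 := h.func _ _ _ g2 ((h.shift _ _).2 hb)
        have := dvd_eq g3 (by omega) (by omega)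
        omega
    · rintro y h1 h2 (⟨g1, g2⟩ | ⟨r, r', g1, g2, g3⟩)
      · exact g2 _ hb
      · have e2 := h.func _ _ _ g2 hb
        have b3 := h.le _ _ g1
        have b4 := h.lt hm g1
        have := dvd_eq g3 (by omega) (by omega)
        omega

/-! ### Part 3: partitions of `Fin (2 * N)` and block relations -/

/-- Reduction modulo `2 * N`. -/
def cz {N : ℕ} (hN : 0 < N) (x : ℤ) : Fin (2 * N) :=
  ⟨(x % (2 * (N : ℤ))).toNat, by
    have h1 := Int.emod_nonneg x (show 2 * (N : ℤ) ≠ 0 by omega)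
    have h2 := Int.emod_lt_of_pos x (show 0 < 2 * (N : ℤ) by omega)
    omega⟩

lemma cz_val {N : ℕ} (hN : 0 < N) (x : ℤ) : ((cz hN x).val : ℤ) = x % (2 * (N : ℤ)) := by
  have h1 := Int.emod_nonneg x (show 2 * (N : ℤ) ≠ 0 by omega)
  simp only [cz]
  omega

lemma cz_eq_iff {N : ℕ} (hN : 0 < N) (x y : ℤ) : cz hN x = cz hN y ↔ 2 * (N : ℤ) ∣ y - x := by
  rw [← Int.modEq_iff_dvd, Int.ModEq, ← cz_val hN, ← cz_val hN, Fin.ext_iff]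
  omega

lemma cz_natCast {N : ℕ} (hN : 0 < N) (a : Fin (2 * N)) : cz hN (a.val : ℤ) = a := by
  apply Fin.ext
  have h := cz_val hN (a.val : ℤ)
  have := a.isLt
  rw [Int.emod_eq_of_lt (by omega) (by omega)] at h
  omega

lemma cz_dvd {N : ℕ} (hN : 0 < N) (x : ℤ) : 2 * (N : ℤ) ∣ x - ((cz hN x).val : ℤ) := by
  rw [cz_val]
  exact Int.dvd_self_sub_emod

lemma negB_cz {N : ℕ} (hN : 0 < N) (x : ℤ) : negB (cz hN x) = cz hN (x + N) := by
  apply Fin.ext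
  have h := cz_val hN (x + N)
  have h' := cz_val hN x
  have : ((negB (cz hN x)).val : ℤ) = ((cz hN x).val + N) % (2 * N) := by
    simp [negB]
  rw [h'] at this
  rw [Int.emod_add_emod] at this
  omega

lemma negB_negB {N : ℕ} (hN : 0 < N) (a : Fin (2 * N)) : negB (negB a) = a := by
  rw [← cz_natCast hN a, negB_cz, negB_cz, cz_eq_iff]
  exact ⟨-1, by ring⟩

/-- The block relation of a partition. -/
def Rpi {N : ℕ} (hN : 0 < N) (π : Finpartition (Finset.univ : Finset (Fin (2 * N)))) (x y : ℤ) :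
    Prop := π.part (cz hN x) = π.part (cz hN y)

lemma mem_NCB {N : ℕ} (π : Finpartition (Finset.univ : Finset (Fin (2 * N)))) :
    π ∈ NCB N ↔ IsNoncrossing π ∧ (∀ B ∈ π.parts, negBlock B ∈ π.parts) ∧
    (π.parts.filter (fun B => negBlock B = B)).card ≤ 1 := by
  unfold NCB fil
  simp

lemma part_negB {N : ℕ} {π : Finpartition (Finset.univ : Finset (Fin (2 * N)))}
    (hneg : ∀ B ∈ π.parts, negBlock B ∈ π.parts) (a : Fin (2 * N)) :
    π.part (negB a) = negBlock (π.part a) := by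
  apply π.part_eq_of_mem (hneg _ (π.part_mem.2 (Finset.mem_univ _)))
  exact Finset.mem_image_of_mem _ (π.mem_part (Finset.mem_univ _))

lemma CR_Rpi {N : ℕ} (hN : 0 < N) {π : Finpartition (Finset.univ : Finset (Fin (2 * N)))}
    (hπ : π ∈ NCB N) : CR (N : ℤ) (Rpi hN π) := by
  obtain ⟨hnc, hneg, -⟩ := (mem_NCB π).1 hπ
  have hsh : ∀ x y, Rpi hN π x y → Rpi hN π (x + N) (y + N) := by
    intro x y h
    unfold Rpi at h ⊢
    rw [← negB_cz, ← negB_cz, part_negB hneg, part_negB hneg, h]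
  have hper : ∀ x y, 2 * (N : ℤ) ∣ y - x → Rpi hN π x y := by
    intro x y h
    unfold Rpi
    rw [(cz_eq_iff hN x y).2 h]
  have hlin : ∀ a b c d : ℤ, 0 ≤ a → a < b → b < c → c < d → d < 2 * N →
      Rpi hN π a c → Rpi hN π b d → Rpi hN π a b := by
    intro a b c d h0 hab hbc hcd hd hac hbd
    unfold Rpi at *
    have va := cz_val hN a
    have vb := cz_val hN b
    have vc := cz_val hN c
    have vd := cz_val hN d
    rw [Int.emod_eq_of_lt (by omega) (by omega)] at va vb vc vd
    refine hnc (cz hN a) (cz hN b) (cz hN c) (cz hN d) (by rw [Fin.lt_def]; omega)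
      (by rw [Fin.lt_def]; omega) (by rw [Fin.lt_def]; omega) _ (π.part_mem.2 (Finset.mem_univ _))
      _ (π.part_mem.2 (Finset.mem_univ _)) (π.mem_part (Finset.mem_univ _)) ?_
      (π.mem_part (Finset.mem_univ _)) ?_
    · rw [hac]; exact π.mem_part (Finset.mem_univ _)
    · rw [hbd]; exact π.mem_part (Finset.mem_univ _)
  have hbase : ∀ a b c d : ℤ, 0 ≤ a → a < 2 * N → a < b → b < c → c < d → d < a + 2 * N →
      Rpi hN π a c → Rpi hN π b d → Rpi hN π a b := by
    intro a b c d h0 h1 hab hbc hcd hd hac hbd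
    have hp : ∀ x, Rpi hN π x (x - 2 * N) := fun x => hper _ _ ⟨-1, by ring⟩
    have hb := hp b
    have hc := hp c
    have hd' := hp d
    by_cases k1 : d < 2 * N
    · exact hlin a b c d h0 hab hbc hcd k1 hac hbd
    by_cases k2 : c < 2 * N
    · have := hlin (d - 2 * N) a b c (by omega) (by omega) (by omega) (by omega) (by omega)
        (hd'.symm.trans hbd.symm) hac
      exact (hbd.trans (hd'.trans this)).symm
    by_cases k3 : b < 2 * N
    · have := hlin (c - 2 * N) (d - 2 * N) a b (by omega) (by omega) (by omega) (by omega)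
        (by omega) (hc.symm.trans hac.symm) (hd'.symm.trans hbd.symm)
      exact hac.trans (hc.trans (this.trans (hd'.symm.trans hbd.symm)))
    · have := hlin (b - 2 * N) (c - 2 * N) (d - 2 * N) a (by omega) (by omega) (by omega)
        (by omega) (by omega) (hb.symm.trans (hbd.trans hd')) (hc.symm.trans hac.symm)
      exact hac.trans (hc.trans (this.symm.trans hb.symm))
  refine ⟨fun x => rfl, fun x y h => h.symm, fun x y z h h' => h.trans h',
    fun x => hper _ _ (by simp), fun x y => ⟨fun h => ?_, hsh x y⟩, ?_⟩
  · have h1 := hsh _ _ h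
    have e : ∀ x : ℤ, Rpi hN π x (x + N + N) := fun x => hper _ _ ⟨1, by ring⟩
    exact (e x).trans (h1.trans (e y).symm)
  · intro a b c d hab hbc hcd hd hac hbd
    have e1 := Int.emod_add_mul_ediv a (2 * (N : ℤ))
    have e2 := Int.emod_nonneg a (show 2 * (N : ℤ) ≠ 0 by omega)
    have e3 := Int.emod_lt_of_pos a (show 0 < 2 * (N : ℤ) by omega)
    set w := 2 * (N : ℤ) * (a / (2 * (N : ℤ))) with hw
    have e : ∀ x : ℤ, Rpi hN π x (x - w) :=
      fun x => hper _ _ ⟨-(a / (2 * (N : ℤ))), by rw [hw]; ring⟩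
    have := hbase (a - w) (b - w) (c - w) (d - w) (by omega) (by omega) (by omega) (by omega)
      (by omega) (by omega) ((e a).symm.trans (hac.trans (e c)))
      ((e b).symm.trans (hbd.trans (e d)))
    exact (e a).trans (this.trans (e b).symm)

lemma Rpi_inj {N : ℕ} (hN : 0 < N) {π π' : Finpartition (Finset.univ : Finset (Fin (2 * N)))}
    (h : ∀ x y, Rpi hN π x y ↔ Rpi hN π' x y) : π = π' := by
  have hpart : ∀ a, π.part a = π'.part a := by
    intro a
    ext b
    have := h (b.val : ℤ) (a.val : ℤ)
    unfold Rpi at this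
    rw [cz_natCast, cz_natCast] at this
    rw [π.mem_part_iff_part_eq_part (Finset.mem_univ _) (Finset.mem_univ _),
      π'.mem_part_iff_part_eq_part (Finset.mem_univ _) (Finset.mem_univ _)]
    exact this
  have key : ∀ π : Finpartition (Finset.univ : Finset (Fin (2 * N))), ∀ B,
      B ∈ π.parts ↔ ∃ a, π.part a = B := by
    intro π B
    constructor
    · intro hB
      obtain ⟨a, ha⟩ := π.nonempty_of_mem_parts hB
      exact ⟨a, π.part_eq_of_mem hB ha⟩
    · rintro ⟨a, rfl⟩
      exact π.part_mem.2 (Finset.mem_univ _)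
  apply Finpartition.ext
  ext B
  rw [key, key]
  simp [hpart]

open Classical in
lemma exists_of_CR {N : ℕ} (hN : 0 < N) {R : ℤ → ℤ → Prop} (h : CR (N : ℤ) R) :
    ∃ π ∈ NCB N, ∀ x y, Rpi hN π x y ↔ R x y := by
  let s : Setoid (Fin (2 * N)) :=
    { r := fun a b => R (a.val : ℤ) (b.val : ℤ)
      iseqv := ⟨fun a => h.refl _, fun hab => h.symm _ _ hab, fun hab hbc => h.trans _ _ _ hab hbc⟩ }
  let π := Finpartition.ofSetoid s
  have hmem : ∀ a b, b ∈ π.part a ↔ R (a.val : ℤ) (b.val : ℤ) := by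
    intro a b
    exact Finpartition.mem_part_ofSetoid_iff_rel
  have hpart : ∀ a b, π.part a = π.part b ↔ R (a.val : ℤ) (b.val : ℤ) := by
    intro a b
    rw [← hmem, π.mem_part_iff_part_eq_part (Finset.mem_univ _) (Finset.mem_univ _), eq_comm]
  have hR : ∀ x y, Rpi hN π x y ↔ R x y := by
    intro x y
    unfold Rpi
    rw [hpart]
    have h1 := h.per_dvd (cz_dvd hN x)
    have h2 := h.per_dvd (cz_dvd hN y)
    exact ⟨fun hh => h.trans _ _ _ (h.symm _ _ h1) (h.trans _ _ _ hh h2),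
      fun hh => h.trans _ _ _ h1 (h.trans _ _ _ hh (h.symm _ _ h2))⟩
  have hblock : ∀ B ∈ π.parts, ∃ a : Fin (2 * N), B = π.part a := by
    intro B hB
    obtain ⟨a, ha⟩ := π.nonempty_of_mem_parts hB
    exact ⟨a, (π.part_eq_of_mem hB ha).symm⟩
  have hnegR : ∀ a : Fin (2 * N), R ((negB a).val : ℤ) ((a.val : ℤ) + N) := by
    intro a
    have := cz_dvd hN ((a.val : ℤ) + N)
    rw [← negB_cz, cz_natCast] at this
    exact h.per_dvd this
  have hnegpart : ∀ a : Fin (2 * N), negBlock (π.part a) = π.part (negB a) := by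
    intro a
    ext y
    have h1 : y ∈ negBlock (π.part a) ↔ negB y ∈ π.part a := by
      unfold negBlock
      rw [Finset.mem_image]
      constructor
      · rintro ⟨z, hz, rfl⟩
        rwa [negB_negB hN]
      · intro hy
        exact ⟨negB y, hy, negB_negB hN y⟩
    rw [h1, hmem, hmem, ← h.shift]
    have h2 := hnegR a
    have h3 := hnegR (negB y)
    rw [negB_negB hN] at h3
    exact ⟨fun hh => h.trans _ _ _ h2 (h.trans _ _ _ hh (h.symm _ _ h3)),
      fun hh => h.trans _ _ _ (h.symm _ _ h2) (h.trans _ _ _ hh h3)⟩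
  refine ⟨π, (mem_NCB π).2 ⟨?_, ?_, ?_⟩, hR⟩
  · intro a b c d hab hbc hcd B hB C hC haB hcB hbC hdC
    rw [Fin.lt_def] at hab hbc hcd
    have hac : R (a.val : ℤ) (c.val : ℤ) := by
      rw [← hmem, π.part_eq_of_mem hB haB]; exact hcB
    have hbd : R (b.val : ℤ) (d.val : ℤ) := by
      rw [← hmem, π.part_eq_of_mem hC hbC]; exact hdC
    have := h.nc _ _ _ _ (by omega) (by omega) (by omega) (by have := d.isLt; omega) hac hbd
    rw [← hpart, π.part_eq_of_mem hB haB, π.part_eq_of_mem hC hbC] at this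
    exact this
  · intro B hB
    obtain ⟨a, rfl⟩ := hblock B hB
    rw [hnegpart]
    exact π.part_mem.2 (Finset.mem_univ _)
  · rw [Finset.card_le_one]
    have hz : ∀ a, negBlock (π.part a) = π.part a → R (a.val : ℤ) ((a.val : ℤ) + N) := by
      intro a ha
      rw [hnegpart, hpart] at ha
      exact h.trans _ _ _ (h.symm _ _ ha) (hnegR a)
    intro B hB C hC
    rw [Finset.mem_filter] at hB hC
    obtain ⟨a, rfl⟩ := hblock B hB.1
    obtain ⟨b, rfl⟩ := hblock C hC.1
    rw [hpart]
    exact h.zero_unique (by omega) (hz a hB.2) (hz b hC.2)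

open Classical in
lemma cnt_eq_card {N : ℕ} (hN : 0 < N) {π : Finpartition (Finset.univ : Finset (Fin (2 * N)))}
    (hπ : π ∈ NCB N) (i : ℤ) (hi : PR (N : ℤ) (Rpi hN π) i i) :
    cntP (N : ℤ) (PR (N : ℤ) (Rpi hN π)) i = (π.part (cz hN i)).card := by
  have hC := CR_Rpi hN hπ
  have hm : (0 : ℤ) < N := by omega
  have hS := hC.NCS hm
  unfold cntP
  refine Finset.card_bij (fun y _ => cz hN y) ?_ ?_ ?_
  · intro y hy
    rw [Finset.mem_filter] at hy
    rw [π.mem_part_iff_part_eq_part (Finset.mem_univ _) (Finset.mem_univ _)]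
    exact hy.2.2.2.1.symm
  · intro y hy y' hy' hyy
    rw [Finset.mem_filter, Finset.mem_Ico] at hy hy'
    exact dvd_eq ((cz_eq_iff hN _ _).1 hyy) (by omega) (by omega)
  · intro b hb
    rw [π.mem_part_iff_part_eq_part (Finset.mem_univ _) (Finset.mem_univ _)] at hb
    have hib : Rpi hN π i (b.val : ℤ) := by
      unfold Rpi
      rw [cz_natCast]; exact hb.symm
    rcases (hC.iff_RP hm _ _).1 hib with ⟨h1, _⟩ | ⟨s, s', h1, h2, h3⟩
    · exact absurd hi (h1 _)
    · have := hS.func _ _ _ h1 hi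
      subst this
      have h4 := hS.shift_dvd h2 ((dvd_sub_comm).1 h3)
      refine ⟨(b.val : ℤ) + (s - s'), ?_, ?_⟩
      · rw [Finset.mem_filter, Finset.mem_Ico]
        exact ⟨⟨hS.le _ _ h4, hS.lt hm h4⟩, h4⟩
      · rw [← cz_natCast hN b, cz_eq_iff, cz_natCast]
        convert h3 using 1
        ring

open Classical in
lemma cnt_eq_zero {m : ℤ} {P : ℤ → ℤ → Prop} (h : NCS m P) (i : ℤ) (hi : ¬ P i i) :
    cntP m P i = 0 := by
  unfold cntP
  rw [Finset.card_eq_zero, Finset.filter_eq_empty_iff]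
  intro y _ hy
  exact hi (h.base _ _ hy)

lemma dvd_blocks_iff {N k : ℕ} (hN : 0 < N) (hk : k ∣ N)
    {π : Finpartition (Finset.univ : Finset (Fin (2 * N)))} (hπ : π ∈ NCB N) :
    (∀ B ∈ π.parts, k ∣ B.card) ↔ ∀ i, k ∣ cntP (N : ℤ) (PR (N : ℤ) (Rpi hN π)) i := by
  have hC := CR_Rpi hN hπ
  have hm : (0 : ℤ) < N := by omega
  have hS := hC.NCS hm
  constructor
  · intro h i
    by_cases hi : PR (N : ℤ) (Rpi hN π) i i
    · rw [cnt_eq_card hN hπ i hi]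
      exact h _ (π.part_mem.2 (Finset.mem_univ _))
    · rw [cnt_eq_zero hS i hi]
      exact dvd_zero k
  · intro h
    have hnz : ∀ x : ℤ, ¬ Rpi hN π x (x + N) → k ∣ (π.part (cz hN x)).card := by
      intro x hx
      obtain ⟨i, hi⟩ := hC.exists_start hm hx
      have e : π.part (cz hN i) = π.part (cz hN x) := hi.2.2.1
      rw [← e, ← cnt_eq_card hN hπ i (hS.base _ _ hi)]
      exact h i
    have hblock : ∀ B ∈ π.parts, ∃ x : ℤ, B = π.part (cz hN x) := by
      intro B hB
      obtain ⟨a, ha⟩ := π.nonempty_of_mem_parts hB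
      exact ⟨a.val, by rw [cz_natCast]; exact (π.part_eq_of_mem hB ha).symm⟩
    intro B hB
    obtain ⟨x, hx⟩ := hblock B hB
    by_cases hz : Rpi hN π x (x + N)
    · have hsum := π.sum_card_parts
      rw [← Finset.add_sum_erase _ _ hB] at hsum
      have h1 : k ∣ ∑ C ∈ π.parts.erase B, C.card := by
        apply Finset.dvd_sum
        intro C hCm
        rw [Finset.mem_erase] at hCm
        obtain ⟨y, hy⟩ := hblock C hCm.2
        rw [hy]
        apply hnz
        intro hzy
        apply hCm.1
        rw [hx, hy]
        exact hC.zero_unique hm hzy hz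
      rw [← Nat.dvd_add_left h1, hsum]
      simp only [Finset.card_univ, Fintype.card_fin]
      exact Dvd.dvd.mul_left hk 2
    · rw [hx]; exact hnz x hz

/-! ### Part 4: counting -/

lemma FW_fin (f : ℤ → ℕ) (N : ℕ) :
    FW f 0 (N : ℤ) = ((∑ t : Fin N, f (t.val : ℤ) : ℕ) : ℤ) - N := by
  induction N with
  | zero => simp [FW]
  | succ N ih =>
    rw [Fin.sum_univ_castSucc]
    have h1 := FW_add f (a := 0) (b := (N : ℤ)) (c := (N : ℤ) + 1) (by omega) (by omega)
    have h2 := FW_succ f (N : ℤ)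
    push_cast at ih ⊢
    simp only [Fin.val_castSucc]
    omega

/-- The finitely supported functions of sum at most `n`. -/
noncomputable def TT (N n : ℕ) : Finset (Fin N →₀ ℕ) :=
  (Finset.range (n + 1)).biUnion (fun s => Finset.finsuppAntidiag Finset.univ s)

lemma mem_TT {N n : ℕ} (g : Fin N →₀ ℕ) : g ∈ TT N n ↔ ∑ t, g t ≤ n := by
  unfold TT
  simp [Finset.mem_finsuppAntidiag]

lemma card_TT (N n : ℕ) : (TT N n).card = (n + N).choose N := by
  unfold TT
  rw [Finset.card_biUnion]
  · rw [← Nat.sum_range_multichoose]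
    refine Finset.sum_congr rfl fun s _ => ?_
    rw [Finset.card_finsuppAntidiag_nat_eq_multichoose]
    simp
  · intro a _ b _ hab
    refine Finset.disjoint_left.2 ?_
    intro g h1 h2
    rw [Finset.mem_finsuppAntidiag] at h1 h2
    exact hab (h1.1.symm.trans h2.1)

lemma mem_NCBdiv {k n : ℕ} (π : Finpartition (Finset.univ : Finset (Fin (2 * (k * n))))) :
    π ∈ NCBdiv k n ↔ π ∈ NCB (k * n) ∧ ∀ B ∈ π.parts, k ∣ B.card := by
  unfold NCBdiv
  rw [fil]
  simp

lemma periodic_int {f : ℤ → ℕ} {m : ℤ} (hper : ∀ t, f (t + m) = f t) (t c : ℤ) :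
    f (t + m * c) = f t := by
  have : Function.Periodic f m := hper
  have := this.int_mul c t
  rw [mul_comm]; simpa using this

lemma card_eq_TT (n k N : ℕ) (hNN : N = k * n) (hn : 1 ≤ n) (hk : 1 ≤ k)
    (S : Finset (Finpartition (Finset.univ : Finset (Fin (2 * N)))))
    (hmem : ∀ π, π ∈ S ↔ π ∈ NCB N ∧ ∀ B ∈ π.parts, k ∣ B.card) :
    S.card = (TT N n).card := by
  have hN : 0 < N := by rw [hNN]; exact Nat.mul_pos hk hn
  have hm : (0 : ℤ) < (N : ℤ) := by omega
  have hkN : k ∣ N := ⟨n, hNN⟩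
  refine Finset.card_bij (fun π _ => Finsupp.equivFunOnFinite.symm
    (fun t : Fin N => cntP (N : ℤ) (PR (N : ℤ) (Rpi hN π)) (t.val : ℤ) / k)) ?_ ?_ ?_
  · intro π hπ
    obtain ⟨h1, h2⟩ := (hmem π).1 hπ
    rw [dvd_blocks_iff hN hkN h1] at h2
    have hS := (CR_Rpi hN h1).NCS hm
    have h3 := hS.FW_le hm
    rw [FW_fin] at h3
    rw [mem_TT]
    simp only [Finsupp.equivFunOnFinite_symm_apply_apply]
    have h4 : k * ∑ t : Fin N, cntP (N : ℤ) (PR (N : ℤ) (Rpi hN π)) (t.val : ℤ) / k =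
        ∑ t : Fin N, cntP (N : ℤ) (PR (N : ℤ) (Rpi hN π)) (t.val : ℤ) := by
      rw [Finset.mul_sum]
      exact Finset.sum_congr rfl fun t _ => Nat.mul_div_cancel' (h2 _)
    have h5 : k * ∑ t : Fin N, cntP (N : ℤ) (PR (N : ℤ) (Rpi hN π)) (t.val : ℤ) / k ≤ k * n := by
      rw [h4]; omega
    exact Nat.le_of_mul_le_mul_left h5 hk
  · intro π hπ π' hπ' heq
    obtain ⟨h1, h2⟩ := (hmem π).1 hπ
    rw [dvd_blocks_iff hN hkN h1] at h2
    obtain ⟨h1', h2'⟩ := (hmem π').1 hπ'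
    rw [dvd_blocks_iff hN hkN h1'] at h2'
    have hC := CR_Rpi hN h1
    have hC' := CR_Rpi hN h1'
    have hS := hC.NCS hm
    have hS' := hC'.NCS hm
    have hfin := Finsupp.equivFunOnFinite.symm.injective heq
    have hcnt : cntP (N : ℤ) (PR (N : ℤ) (Rpi hN π)) = cntP (N : ℤ) (PR (N : ℤ) (Rpi hN π')) := by
      funext i
      have e1 := Int.emod_add_mul_ediv i N
      have e2 := Int.emod_nonneg i hm.ne'
      have e3 := Int.emod_lt_of_pos i hm
      rw [← e1, periodic_int hS.cnt_shift, periodic_int hS'.cnt_shift]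
      have h3 := congrFun hfin ⟨(i % N).toNat, by omega⟩
      simp only [Int.toNat_of_nonneg e2] at h3
      rw [← Nat.mul_div_cancel' (h2 (i % N)), ← Nat.mul_div_cancel' (h2' (i % N)), h3]
    have hP : PR (N : ℤ) (Rpi hN π) = PR (N : ℤ) (Rpi hN π') := by
      funext i j
      rw [eq_iff_iff, hS.iff_StF hm, hS'.iff_StF hm, hcnt]
    apply Rpi_inj hN
    intro x y
    rw [hC.iff_RP hm, hC'.iff_RP hm, hP]
  · intro g hg
    rw [mem_TT] at hg
    let f : ℤ → ℕ := fun j => k * g ⟨(j % N).toNat, by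
      have e2 := Int.emod_nonneg j hm.ne'
      have e3 := Int.emod_lt_of_pos j hm
      omega⟩
    have hft : ∀ t : Fin N, f (t.val : ℤ) = k * g t := by
      intro t
      simp only [f]
      congr 2
      apply Fin.ext
      have := t.isLt
      simp only
      rw [Int.emod_eq_of_lt (by omega) (by omega)]
      simp
    have hper : ∀ t, f (t + N) = f t := by
      intro t
      simp [f]
    have hF : FW f 0 N ≤ 0 := by
      rw [FW_fin]
      simp only [hft]
      rw [← Finset.mul_sum]
      have := Nat.mul_le_mul_left k hg
      omega
    have hS := NCS_StF f N hper
    obtain ⟨π, h1, h2⟩ := exists_of_CR hN (hS.CR hm)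
    have hR : Rpi hN π = RP (N : ℤ) (StF f) := by
      funext x y
      exact propext (h2 x y)
    have hP : PR (N : ℤ) (Rpi hN π) = StF f := by
      funext i j
      rw [hR]
      exact propext (hS.PR_iff hm i j)
    have hcnt : ∀ i, cntP (N : ℤ) (PR (N : ℤ) (Rpi hN π)) i = f i := by
      intro i
      rw [hP]
      exact cnt_StF f N hm hper hF i
    refine ⟨π, (hmem π).2 ⟨h1, ?_⟩, ?_⟩
    · rw [dvd_blocks_iff hN hkN h1]
      intro i
      rw [hcnt]
      exact Dvd.intro _ rfl
    · ext t
      simp only [Finsupp.equivFunOnFinite_symm_apply_apply]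
      rw [hcnt, hft]
      exact Nat.mul_div_cancel_left _ hk

/-- The number of `k`-divisible non-crossing partitions of type `B_{kn}` equals
`binom((k+1)n, n)`. -/
theorem card_typeB_k_divisible (n k : ℕ) (hn : 1 ≤ n) (hk : 1 ≤ k) :
    (NCBdiv k n).card = Nat.choose ((k + 1) * n) n := by
  rw [card_eq_TT n k (k * n) rfl hn hk _ mem_NCBdiv, card_TT, ← Nat.choose_symm_add]
  congr 1
  ring
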